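/- Let q be an odd prime power. For every j ∈ {1,…,q} with j ≠ (q+1)/2, the point set S_j of PG(3,q²) has cardinality q²(q²+1)(q−1)/2 + q² + 1. -/

import Mathlib

noncomputable section

open Matrix

/-- The points of `PG(3,q²)`: the projectivization of `F⁴` where `F = 𝔽_{q²}`. -/
abbrev PGPoint (F : Type*) [Field F] := Projectivization F (Fin 4 → F)

/-- The form `F_γ(X₁,X₂,X₃,X₄) = X₁^q X₄ + X₁ X₄^q − X₂^{q+1} − X₃^{q+1}
    − γ (X₁X₄ − X₂X₃)^{(q+1)/2}`. -/
def Fgam {F : Type*} [Field F] (q : ℕ) (γ : F) (x : Fin 4 → F) : F :=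
  x 0 ^ q * x 3 + x 0 * x 3 ^ q - x 1 ^ (q + 1) - x 2 ^ (q + 1)
    - γ * (x 0 * x 3 - x 1 * x 2) ^ ((q + 1) / 2)

/-- The point set `C_γ` of `PG(3,q²)`, the zero locus of `F_γ`. -/
def Cgam {F : Type*} [Field F] (q : ℕ) (γ : F) : Set (PGPoint F) :=
  {P | ∀ (v : Fin 4 → F) (hv : v ≠ 0), P = Projectivization.mk F v hv → Fgam q γ v = 0}

/-- Kronecker product of two 2×2 matrices, as a 4×4 matrix. -/
def kron {F : Type*} [Field F] (A B : Matrix (Fin 2) (Fin 2) F) :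
    Matrix (Fin 4) (Fin 4) F :=
  Matrix.of fun i j =>
    A ⟨i.val / 2, by have := i.isLt; omega⟩ ⟨j.val / 2, by have := j.isLt; omega⟩ *
    B ⟨i.val % 2, by have := i.isLt; omega⟩ ⟨j.val % 2, by have := j.isLt; omega⟩

/-- Entrywise `q`-th power (the matrix `A^q`). -/
def matq {F : Type*} [Field F] (q : ℕ) (A : Matrix (Fin 2) (Fin 2) F) :
    Matrix (Fin 2) (Fin 2) F :=
  A.map (· ^ q)

/-- The orbit of a point of `PG(3,q²)` under the group `K ≅ PSL(2,q²)` of projectivities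
    induced by the matrices `A^q ⊗ A` with `A ∈ SL(2,𝔽_{q²})`. -/
def Korb {F : Type*} [Field F] (q : ℕ) (P : PGPoint F) : Set (PGPoint F) :=
  {P' | ∃ A : Matrix (Fin 2) (Fin 2) F, A.det = 1 ∧
    ∃ (v : Fin 4 → F) (hv : v ≠ 0) (hw : Matrix.vecMul v (kron (matq q A) A) ≠ 0),
      P = Projectivization.mk F v hv ∧ P' = Projectivization.mk F _ hw}

/-- The orbit of a point of `PG(3,q²)` under the group `G ≅ PGL(2,q²)` of projectivities
    induced by the matrices `A^q ⊗ A` with `A ∈ GL(2,𝔽_{q²})`. -/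
def Gorb {F : Type*} [Field F] (q : ℕ) (P : PGPoint F) : Set (PGPoint F) :=
  {P' | ∃ A : Matrix (Fin 2) (Fin 2) F, A.det ≠ 0 ∧
    ∃ (v : Fin 4 → F) (hv : v ≠ 0) (hw : Matrix.vecMul v (kron (matq q A) A) ≠ 0),
      P = Projectivization.mk F v hv ∧ P' = Projectivization.mk F _ hw}

/-- The Hermitian Veronese curve `O = {(1,t,t^q,t^{q+1})} ∪ {(0,0,0,1)}`. -/
def Oset (F : Type*) [Field F] (q : ℕ) : Set (PGPoint F) :=
  {P | (∃ (t : F) (hv : ![1, t, t ^ q, t ^ (q + 1)] ≠ 0),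
        P = Projectivization.mk F _ hv) ∨
    ∃ (hv : (![0, 0, 0, 1] : Fin 4 → F) ≠ 0), P = Projectivization.mk F _ hv}

/-- The Baer subgeometry `Σ = {(a,b,b^q,c) : a,c ∈ 𝔽_q, b ∈ 𝔽_{q²}}`. -/
def SigmaSet (F : Type*) [Field F] (q : ℕ) : Set (PGPoint F) :=
  {P | ∃ (a b c : F) (hv : ![a, b, b ^ q, c] ≠ 0),
    a ^ q = a ∧ c ^ q = c ∧ P = Projectivization.mk F _ hv}

/-- The hyperbolic quadric `Q⁺(3,q²) : X₁X₄ − X₂X₃ = 0`. -/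
def Qplus (F : Type*) [Field F] : Set (PGPoint F) :=
  {P | ∀ (v : Fin 4 → F) (hv : v ≠ 0), P = Projectivization.mk F v hv →
    v 0 * v 3 - v 1 * v 2 = 0}

/-- A line of `PG(3,q²)`: the set of points lying in a 2-dimensional subspace. -/
def IsLine {F : Type*} [Field F] (ℓ : Set (PGPoint F)) : Prop :=
  ∃ W : Submodule F (Fin 4 → F), Module.finrank F W = 2 ∧ ℓ = {P | P.rep ∈ W}

/-- A plane of `PG(3,q²)`: the set of points lying in a 3-dimensional subspace. -/
def IsPlane {F : Type*} [Field F] (π : Set (PGPoint F)) : Prop :=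
  ∃ W : Submodule F (Fin 4 → F), Module.finrank F W = 3 ∧ π = {P | P.rep ∈ W}

section counting

variable {F : Type*} [Field F]

lemma exists_pow_eq_of_pow_eq_one {ξ : F} (hξ : ∀ x : F, x ≠ 0 → ∃ m : ℕ, x = ξ ^ m)
    {a b : ℕ} (hb : 0 < b) (hord : orderOf ξ = a * b) {c : F} (hc0 : c ≠ 0) (hc : c ^ b = 1) :
    ∃ y, y ^ a = c := by
  obtain ⟨m, rfl⟩ := hξ c hc0
  rw [← pow_mul] at hc
  have h := orderOf_dvd_of_pow_eq_one hc
  rw [hord] at h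
  obtain ⟨l, rfl⟩ := Nat.dvd_of_mul_dvd_mul_right hb h
  exact ⟨ξ ^ l, by rw [← pow_mul, mul_comm]⟩

lemma card_pow_eq [Fintype F] [DecidableEq F] {ξ : F} {a b : ℕ} (ha : 0 < a) (hb : 0 < b)
    (hord : orderOf ξ = a * b) {c y : F} (hc0 : c ≠ 0) (hy : y ^ a = c) :
    (Finset.univ.filter fun x : F => x ^ a = c).card = a := by
  have hprim : IsPrimitiveRoot ξ (a * b) := hord ▸ IsPrimitiveRoot.orderOf ξ
  have hprim' : IsPrimitiveRoot (ξ ^ b) a := hprim.pow (by positivity) (mul_comm a b)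
  have hcard := hprim'.card_nthRoots c
  rw [if_pos ⟨y, hy⟩] at hcard
  have hnd := hprim'.nthRoots_nodup hc0
  rw [← Multiset.toFinset_card_of_nodup hnd] at hcard
  refine Eq.trans ?_ hcard
  congr 1
  ext x
  simp [Polynomial.mem_nthRoots ha]

/-- The pairs `(w, d)` with `w ^ (q + 1) = d + d ^ q - γ * d ^ ((q + 1) / 2)`, `q = 2 * k + 1`. -/
def affinePairs [Fintype F] [DecidableEq F] (k : ℕ) (γ : F) : Finset (F × F) :=
  Finset.univ.filter fun z =>
    z.1 ^ (2 * k + 2) = z.2 + z.2 ^ (2 * k + 1) - γ * z.2 ^ (k + 1)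

lemma card_affinePairs [Fintype F] [DecidableEq F] {k : ℕ} (hk : 0 < k) {ξ ω t e : F}
    (hξ : ∀ x : F, x ≠ 0 → ∃ m : ℕ, x = ξ ^ m)
    (hord : orderOf ξ = (2 * k + 2) * (2 * k))
    (hadd : ∀ x y : F, (x - y) ^ (2 * k + 1) = x ^ (2 * k + 1) - y ^ (2 * k + 1))
    (hω0 : ω ≠ 0) (hω2 : ω ^ 2 ≠ 1) (hω2' : ω ^ 2 ≠ -1) (ht : t ^ k = ω)
    (he : ω ^ (2 * k + 2) = e) (he2 : e ^ 2 = 1) :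
    (affinePairs k (ω + ω⁻¹)).card = ((2 * k + 1) ^ 2 + 1) * k + 1 := by
  set γ := ω + ω⁻¹ with hγ
  have hcard1 : ∀ x : F, x ≠ 0 → x ^ ((2 * k + 2) * (2 * k)) = 1 := by
    intro x hx
    obtain ⟨m, rfl⟩ := hξ x hx
    rw [← pow_mul, mul_comm, pow_mul, ← hord, pow_orderOf_eq_one, one_pow]
  have he0 : e ≠ 0 := by rintro rfl; simp at he2
  have hA : (Finset.univ.filter fun x : F => x ^ (2 * k * (k + 1)) = e).card
      = 2 * k * (k + 1) := by
    refine card_pow_eq (y := t) (b := 2) (by positivity) (by norm_num)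
      (hord.trans (by ring)) he0 ?_
    rw [← he, ← ht, ← pow_mul]; congr 1; ring
  have hB1 : (Finset.univ.filter fun x : F => x ^ k = ω).card = k :=
    card_pow_eq (b := 4 * (k + 1)) hk (by positivity) (hord.trans (by ring)) hω0 ht
  have hB2 : (Finset.univ.filter fun x : F => x ^ k = ω⁻¹).card = k :=
    card_pow_eq (b := 4 * (k + 1)) hk (by positivity) (hord.trans (by ring))
      (inv_ne_zero hω0) (y := t⁻¹) (by rw [inv_pow, ht])
  have hγ0 : γ ≠ 0 := by
    intro h
    apply hω2'
    have : ω * γ = ω ^ 2 + 1 := by rw [hγ]; field_simp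
    rw [h, mul_zero] at this
    linear_combination -this
  have hωq : ω ^ (2 * k + 1) = e * ω⁻¹ := by
    rw [← he]; field_simp; ring
  have hγq : γ ^ (2 * k + 1) = e * γ := by
    have h1 : γ = ω - (-ω⁻¹) := by rw [hγ]; ring
    have h2 : (-ω⁻¹) ^ (2 * k + 1) = - (e * ω) := by
      rw [Odd.neg_pow ⟨k, rfl⟩, inv_pow, hωq, mul_inv, inv_inv]
      have : e⁻¹ = e := by field_simp; exact he2.symm
      rw [this]
    rw [h1, hadd, h2, hωq]; ring
  have hωinv : ω ≠ ω⁻¹ := by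
    intro h; apply hω2
    rw [sq]; nth_rewrite 2 [h]; exact mul_inv_cancel₀ hω0
  have hfactor : ∀ d : F, d + d ^ (2 * k + 1) - γ * d ^ (k + 1)
      = d * ((d ^ k - ω) * (d ^ k - ω⁻¹)) := by
    intro d
    have : ω * ω⁻¹ = 1 := mul_inv_cancel₀ hω0
    rw [hγ]
    linear_combination (-d) * this
  have key : ∀ d : F,
      (Finset.univ.filter fun w : F =>
        w ^ (2 * k + 2) = d + d ^ (2 * k + 1) - γ * d ^ (k + 1)).card
        + (2 * k + 1) * (if d ^ k = ω then 1 else 0)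
        + (2 * k + 1) * (if d ^ k = ω⁻¹ then 1 else 0)
      = (if d = 0 then 1 else 0)
        + (2 * k + 2) * (if d ^ (2 * k * (k + 1)) = e then 1 else 0) := by
    intro d
    have hzero : (Finset.univ.filter fun w : F => w ^ (2 * k + 2) = 0).card = 1 := by
      rw [Finset.card_eq_one]
      exact ⟨0, by ext; simp⟩
    by_cases hd : d = 0
    · subst hd
      have hk' : k ≠ 0 := hk.ne'
      have h1 : (0 : F) ^ k ≠ ω := by rw [zero_pow hk']; exact hω0.symm
      have h2 : (0 : F) ^ k ≠ ω⁻¹ := by rw [zero_pow hk']; exact (inv_ne_zero hω0).symm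
      have h3 : (0 : F) ^ (2 * k * (k + 1)) ≠ e := by
        rw [zero_pow (by positivity)]; exact he0.symm
      rw [if_neg h1, if_neg h2, if_neg h3, if_pos rfl]
      simpa using hzero
    rw [if_neg hd]
    have hpow : d ^ (2 * k * (k + 1)) = (d ^ k) ^ (2 * k + 2) := by
      rw [← pow_mul]; congr 1; ring
    by_cases h1 : d ^ k = ω
    · have h3 : d ^ (2 * k * (k + 1)) = e := by rw [hpow, h1, he]
      rw [hfactor, h3, h1, if_pos rfl, if_pos rfl, if_neg hωinv, sub_self, zero_mul, mul_zero,
        hzero]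
      ring
    by_cases h2 : d ^ k = ω⁻¹
    · have h3 : d ^ (2 * k * (k + 1)) = e := by
        rw [hpow, h2, inv_pow, he]; field_simp; exact he2.symm
      rw [hfactor, h3, h2, if_neg hωinv.symm, if_pos rfl, if_pos rfl, sub_self, mul_zero,
        mul_zero, hzero]
      ring
    rw [if_neg h1, if_neg h2]
    set g := d + d ^ (2 * k + 1) - γ * d ^ (k + 1) with hg
    have hg0 : g ≠ 0 := by
      rw [hg, hfactor]
      exact mul_ne_zero hd (mul_ne_zero (sub_ne_zero.2 h1) (sub_ne_zero.2 h2))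
    have hdd : (d ^ (2 * k + 1)) ^ (2 * k + 1) = d := by
      have : (d ^ (2 * k + 1)) ^ (2 * k + 1) = d ^ ((2 * k + 2) * (2 * k)) * d := by ring
      rw [this, hcard1 d hd, one_mul]
    have hgq : g ^ (2 * k + 1) = d ^ (2 * k + 1) + d
        - e * γ * d ^ (2 * k * (k + 1)) * d ^ (k + 1) := by
      have h : g = d - ((γ * d ^ (k + 1)) - d ^ (2 * k + 1)) := by rw [hg]; ring
      rw [h, hadd, hadd, hdd, mul_pow, hγq]
      ring
    have hiff : g ^ (2 * k) = 1 ↔ d ^ (2 * k * (k + 1)) = e := by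
      have h : g ^ (2 * k) = 1 ↔ g ^ (2 * k + 1) = g := by
        rw [pow_succ]
        exact (mul_eq_right₀ hg0).symm
      rw [h, hgq, hg]
      have hdk : γ * d ^ (k + 1) ≠ 0 := mul_ne_zero hγ0 (pow_ne_zero _ hd)
      constructor
      · intro h
        have h' : e * d ^ (2 * k * (k + 1)) = 1 := by
          apply mul_right_cancel₀ hdk
          linear_combination -h
        linear_combination e * h' - d ^ (2 * k * (k + 1)) * he2
      · intro h
        rw [h]
        linear_combination (-γ * d ^ (k + 1)) * he2
    by_cases h3 : d ^ (2 * k * (k + 1)) = e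
    · obtain ⟨y, hy⟩ := exists_pow_eq_of_pow_eq_one hξ (by positivity) hord hg0 (hiff.2 h3)
      rw [if_pos h3, card_pow_eq (by positivity) (by positivity) hord hg0 hy]
      ring
    · suffices h : ∀ w : F, w ^ (2 * k + 2) ≠ g by
        rw [if_neg h3, Finset.filter_false_of_mem fun w _ => h w]
        simp
      intro w hw
      apply h3
      rw [← hiff, ← hw, ← pow_mul]
      apply hcard1
      rintro rfl
      exact hg0 (by rw [← hw, zero_pow (by positivity)])
  have hsum := Finset.sum_congr (rfl : (Finset.univ : Finset F) = Finset.univ)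
    fun d _ => key d
  simp only [Finset.sum_add_distrib, ← Finset.mul_sum, Finset.sum_boole, hA, hB1, hB2,
    Nat.cast_id] at hsum
  have hS : (affinePairs k γ).card = ∑ d : F, (Finset.univ.filter fun w : F =>
        w ^ (2 * k + 2) = d + d ^ (2 * k + 1) - γ * d ^ (k + 1)).card := by
    simp only [affinePairs, Finset.card_filter]
    rw [Fintype.sum_prod_type, Finset.sum_comm]
  rw [← hS] at hsum
  have h1 : (Finset.univ.filter fun d : F => d = 0).card = 1 := by
    rw [Finset.card_eq_one]
    exact ⟨0, by ext; simp⟩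
  rw [h1] at hsum
  nlinarith [hsum]

end counting

section points

variable {F : Type*} [Field F]

lemma Fgam_smul (k : ℕ) (γ a : F) (v : Fin 4 → F) :
    Fgam (2 * k + 1) γ (a • v) = a ^ (2 * k + 2) * Fgam (2 * k + 1) γ v := by
  have h : (2 * k + 1 + 1) / 2 = k + 1 := by omega
  simp only [Fgam, h, Pi.smul_apply, smul_eq_mul]
  have : a * v 0 * (a * v 3) - a * v 1 * (a * v 2) = a ^ 2 * (v 0 * v 3 - v 1 * v 2) := by ring
  rw [this, mul_pow (a ^ 2)]
  ring

lemma mk_mem_Cgam {k : ℕ} {γ : F} {v : Fin 4 → F} (hv : v ≠ 0) :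
    Projectivization.mk F v hv ∈ Cgam (2 * k + 1) γ ↔ Fgam (2 * k + 1) γ v = 0 := by
  constructor
  · intro h; exact h v hv rfl
  · intro h w hw hP
    obtain ⟨a, rfl⟩ := (Projectivization.mk_eq_mk_iff' F v w hv hw).1 hP
    rw [Fgam_smul] at h
    rcases mul_eq_zero.1 h with h | h
    · exact absurd (by rw [eq_zero_of_pow_eq_zero h, zero_smul]) hv
    · exact h

/-- The point `(1, w + x ^ q, x, d + (w + x ^ q) x)`. -/
def affinePoint (q : ℕ) (z : F × F × F) : PGPoint F :=
  Projectivization.mk F ![1, z.2.1 + z.1 ^ q, z.1, z.2.2 + (z.2.1 + z.1 ^ q) * z.1]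
    (fun h => one_ne_zero (congrFun h 0))

/-- The point `(0, 0, 0, 1)`. -/
def pointAtInfinity (F : Type*) [Field F] : PGPoint F :=
  Projectivization.mk F ![0, 0, 0, 1] (fun h => one_ne_zero (congrFun h 3))

lemma affinePoint_injective (q : ℕ) : Function.Injective (affinePoint (F := F) q) := by
  rintro ⟨x, w, d⟩ ⟨x', w', d'⟩ h
  obtain ⟨a, ha⟩ := (Projectivization.mk_eq_mk_iff' F _ _ _ _).1 h
  have h0 := congrFun ha 0
  have h1 := congrFun ha 1
  have h2 := congrFun ha 2
  have h3 := congrFun ha 3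
  simp at h0 h1 h2 h3
  subst h0
  simp only [one_mul] at h1 h2 h3
  subst h2
  have hw := add_right_cancel h1
  subst hw
  have hd := add_right_cancel h3
  subst hd
  rfl

lemma pointAtInfinity_ne_affinePoint (q : ℕ) (z : F × F × F) :
    affinePoint q z ≠ pointAtInfinity F := by
  intro h
  obtain ⟨a, ha⟩ := (Projectivization.mk_eq_mk_iff' F _ _ _ _).1 h
  have h0 := congrFun ha 0
  simp at h0

lemma affinePoint_mem_Cgam {k : ℕ} {γ : F}
    (hadd : ∀ x y : F, (x + y) ^ (2 * k + 1) = x ^ (2 * k + 1) + y ^ (2 * k + 1))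
    (hinv : ∀ x : F, (x ^ (2 * k + 1)) ^ (2 * k + 1) = x) (x w d : F) :
    affinePoint (2 * k + 1) (x, w, d) ∈ Cgam (2 * k + 1) γ ↔
      w ^ (2 * k + 2) = d + d ^ (2 * k + 1) - γ * d ^ (k + 1) := by
  have h : (2 * k + 1 + 1) / 2 = k + 1 := by omega
  rw [affinePoint, mk_mem_Cgam]
  simp only [Fgam, h]
  simp only [Fin.isValue, cons_val_zero, cons_val_one, cons_val, one_pow, one_mul]
  have hpow : ∀ y : F, y ^ (2 * k + 1 + 1) = y ^ (2 * k + 1) * y := fun y => pow_succ _ _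
  have hw : w ^ (2 * k + 2) = w ^ (2 * k + 1) * w := pow_succ _ _
  rw [hpow, hpow, hw, hadd d, mul_pow, hadd w, hinv, add_sub_cancel_right]
  constructor
  · intro h; linear_combination -h
  · intro h; linear_combination -h

lemma Cgam_eq [Fintype F] [DecidableEq F] {k : ℕ} {ω e : F}
    (hadd : ∀ x y : F, (x + y) ^ (2 * k + 1) = x ^ (2 * k + 1) + y ^ (2 * k + 1))
    (hinv : ∀ x : F, (x ^ (2 * k + 1)) ^ (2 * k + 1) = x)
    (hω4 : ω ^ 4 ≠ 1) (he : ω ^ (2 * k + 2) = e) (he2 : e ^ 2 = 1) (hω0 : ω ≠ 0) :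
    Cgam (2 * k + 1) (ω + ω⁻¹) = insert (pointAtInfinity F)
      (affinePoint (2 * k + 1) ''
        (Finset.univ ×ˢ affinePairs k (ω + ω⁻¹) : Finset (F × F × F))) := by
  have hk2 : (2 * k + 1 + 1) / 2 = k + 1 := by omega
  ext P
  simp only [Set.mem_insert_iff, Set.mem_image, Finset.mem_coe,
    Finset.mem_product, Finset.mem_univ, true_and, Prod.exists]
  constructor
  · intro hP
    induction P using Projectivization.ind with
    | h v hv =>
    rw [mk_mem_Cgam] at hP
    by_cases h0 : v 0 = 0
    · left
      rw [pointAtInfinity, Projectivization.mk_eq_mk_iff']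
      suffices h : v 1 = 0 ∧ v 2 = 0 by
        refine ⟨v 3, ?_⟩
        ext i; fin_cases i <;> simp [h0, h.1, h.2]
      simp only [Fgam, h0, hk2] at hP
      rw [zero_pow (by positivity)] at hP
      have hP' : v 1 ^ (2 * k + 2) + v 2 ^ (2 * k + 2)
          + (ω + ω⁻¹) * (-(v 1 * v 2)) ^ (k + 1) = 0 := by
        have : (0 * v 3 - v 1 * v 2) = -(v 1 * v 2) := by ring
        rw [this] at hP
        linear_combination -hP
      by_cases h1 : v 1 = 0
      · refine ⟨h1, ?_⟩
        rw [h1] at hP'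
        simpa using hP'
      exfalso
      set z := -(v 2 / v 1) with hz
      have hv2 : v 2 = - z * v 1 := by rw [hz]; field_simp
      have hquad : (z ^ (k + 1) + ω) * (z ^ (k + 1) + ω⁻¹) = 0 := by
        have h : v 1 ^ (2 * k + 2) * ((z ^ (k + 1) + ω) * (z ^ (k + 1) + ω⁻¹)) = 0 := by
          have e1 : v 2 ^ (2 * k + 2) = z ^ (2 * k + 2) * v 1 ^ (2 * k + 2) := by
            rw [hv2, mul_pow, Even.neg_pow ⟨k + 1, by ring⟩]
          have e2 : (-(v 1 * v 2)) ^ (k + 1) = z ^ (k + 1) * v 1 ^ (2 * k + 2) := by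
            have : -(v 1 * v 2) = z * v 1 ^ 2 := by rw [hv2]; ring
            rw [this, mul_pow, ← pow_mul]; ring_nf
          rw [e1, e2] at hP'
          have : ω * ω⁻¹ = 1 := mul_inv_cancel₀ hω0
          linear_combination hP' + v 1 ^ (2 * k + 2) * this
        exact (mul_eq_zero.1 h).resolve_left (pow_ne_zero _ h1)
      have hz2 : ∀ u : F, u ^ 4 ≠ 1 → u ^ (4 * (k + 1)) = 1 → u ≠ 0 → z ^ (k + 1) + u ≠ 0 := by
        intro u hu4 huk hu0 hzu
        have hzu' : z ^ (k + 1) = -u := by linear_combination hzu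
        apply hu4
        have hzz : z ^ (4 * k * (k + 1)) = 1 := by
          have hz0 : z ≠ 0 := by
            intro h
            rw [h, zero_pow (by positivity)] at hzu'
            exact hu0 (neg_eq_zero.1 hzu'.symm)
          have := hinv z
          apply mul_right_cancel₀ hz0
          rw [one_mul]
          nth_rewrite 3 [← this]
          rw [← pow_mul, ← pow_succ]
          congr 1; ring
        have : u ^ (4 * k) = 1 := by
          rw [show 4 * k * (k + 1) = (k + 1) * (4 * k) by ring, pow_mul, hzu',
            Even.neg_pow ⟨2 * k, by ring⟩] at hzz
          exact hzz
        rw [show 4 * (k + 1) = 4 * k + 4 by ring, pow_add, this, one_mul] at huk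
        exact huk
      have hωk : ω ^ (4 * (k + 1)) = 1 := by
        rw [show 4 * (k + 1) = (2 * k + 2) * 2 by ring, pow_mul, he, he2]
      rcases mul_eq_zero.1 hquad with h | h
      · exact hz2 ω hω4 hωk hω0 h
      · refine hz2 ω⁻¹ ?_ ?_ (inv_ne_zero hω0) h
        · rwa [inv_pow, ne_eq, inv_eq_one]
        · rw [inv_pow, hωk, inv_one]
    · right
      set x := v 2 / v 0 with hx
      set w := v 1 / v 0 - x ^ (2 * k + 1) with hw
      set d := v 3 / v 0 - v 1 / v 0 * x with hd
      have heq : affinePoint (2 * k + 1) (x, w, d) = Projectivization.mk F v hv := by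
        rw [affinePoint, Projectivization.mk_eq_mk_iff']
        refine ⟨(v 0)⁻¹, ?_⟩
        ext i
        fin_cases i
        · simp [h0]
        · simp [hw, div_eq_inv_mul]
        · simp [hx, div_eq_inv_mul]
        · simp [hd, hw, div_eq_inv_mul]
      refine ⟨x, w, d, ?_, heq⟩
      simp only [affinePairs, Finset.mem_filter, Finset.mem_univ, true_and]
      rw [← affinePoint_mem_Cgam hadd hinv x w d, heq, mk_mem_Cgam]
      exact hP
  · rintro (rfl | ⟨x, w, d, h, rfl⟩)
    · rw [pointAtInfinity, mk_mem_Cgam]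
      simp [Fgam, hk2]
    · rw [affinePoint_mem_Cgam hadd hinv]
      simpa [affinePairs] using h

end points

/-- Lemma 2.6 ii): `|S_j| = q²(q²+1)(q−1)/2 + q² + 1`. -/
theorem stmt4 {F : Type*} [Field F] [Fintype F] (p n q : ℕ) (hp : p.Prime)
    (hodd : Odd p) (hn : 0 < n) (hq : q = p ^ n) (hF : Fintype.card F = q ^ 2)
    (ξ : F) (hξ : ∀ x : F, x ≠ 0 → ∃ m : ℕ, x = ξ ^ m)
    (j : ℕ) (hj1 : 1 ≤ j) (hjq : j ≤ q) (hjne : j ≠ (q + 1) / 2) :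
    (Cgam q (ξ ^ (j * (q - 1) / 2) + (ξ ^ (j * (q - 1) / 2))⁻¹)).ncard
      = q ^ 2 * (q ^ 2 + 1) * (q - 1) / 2 + q ^ 2 + 1 := by
  classical
  have hqodd : Odd q := hq ▸ hodd.pow
  have hq1 : 1 < q := hq ▸ Nat.one_lt_pow hn.ne' hp.one_lt
  have hchar : CharP F p := by
    have := Fact.mk hp
    refine charP_of_card_eq_prime_pow (f := n * 2) ?_
    rw [hF, hq, pow_mul]
  have := Fact.mk hp
  have hadd : ∀ x y : F, (x + y) ^ q = x ^ q + y ^ q := fun x y => by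
    rw [hq]; exact add_pow_char_pow x y p n
  have hsub : ∀ x y : F, (x - y) ^ q = x ^ q - y ^ q := fun x y => by
    rw [hq]; exact sub_pow_char_pow x y n
  have hinv : ∀ x : F, (x ^ q) ^ q = x := fun x => by
    rw [← pow_mul, ← sq, ← hF, FiniteField.pow_card]
  obtain ⟨k, rfl⟩ := hqodd
  have hk : 0 < k := by omega
  have hξ0 : ξ ≠ 0 := by
    rintro rfl
    obtain ⟨m, hm⟩ := hξ (-1) (by simp)
    rcases m.eq_zero_or_pos with rfl | hm0
    · have : ringChar F ≠ 2 := by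
        rw [ringChar.eq F p]
        rintro rfl
        exact absurd hodd (by decide)
      exact Ring.neg_one_ne_one_of_char_ne_two this (by simpa using hm)
    · rw [zero_pow hm0.ne'] at hm
      simp at hm
  have hord : orderOf ξ = (2 * k + 2) * (2 * k) := by
    have h : ∀ x : Fˣ, x ∈ Subgroup.zpowers (Units.mk0 ξ hξ0) := fun x => by
      obtain ⟨m, hm⟩ := hξ x x.ne_zero
      exact ⟨m, Units.ext (by simp [hm])⟩
    have hu := orderOf_eq_card_of_forall_mem_zpowers h
    rw [← orderOf_units, Units.val_mk0, Nat.card_units, Nat.card_eq_fintype_card, hF] at hu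
    rw [hu, show (2 * k + 1) ^ 2 = (2 * k + 2) * (2 * k) + 1 by ring, Nat.add_sub_cancel]
  have hexp : j * (2 * k + 1 - 1) / 2 = j * k := by
    rw [Nat.add_sub_cancel, mul_left_comm, Nat.mul_div_cancel_left _ (by norm_num)]
  have hres : (2 * k + 1) ^ 2 * ((2 * k + 1) ^ 2 + 1) * (2 * k + 1 - 1) / 2
      = (2 * k + 1) ^ 2 * ((2 * k + 1) ^ 2 + 1) * k := by
    rw [Nat.add_sub_cancel, mul_left_comm, Nat.mul_div_cancel_left _ (by norm_num)]
  rw [hexp, hres]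
  set ω := ξ ^ (j * k) with hω
  have hω0 : ω ≠ 0 := pow_ne_zero _ hξ0
  have hω4 : ω ^ 4 ≠ 1 := by
    intro h
    rw [hω, ← pow_mul] at h
    have hdvd := orderOf_dvd_of_pow_eq_one h
    rw [hord, show j * k * 4 = (2 * j) * (2 * k) by ring] at hdvd
    obtain ⟨c, hc⟩ := Nat.dvd_of_mul_dvd_mul_right (by positivity) hdvd
    rcases c with _ | _ | c
    · omega
    · omega
    · nlinarith
  have he2 : (ω ^ (2 * k + 2)) ^ 2 = 1 := by
    rw [hω, ← pow_mul, ← pow_mul,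
      show j * k * ((2 * k + 2) * 2) = ((2 * k + 2) * (2 * k)) * j by ring, pow_mul, ← hord, pow_orderOf_eq_one, one_pow]
  have hcard := card_affinePairs hk hξ hord hsub hω0
    (fun h => hω4 (by rw [show ω ^ 4 = (ω ^ 2) ^ 2 by ring, h, one_pow]))
    (fun h => hω4 (by rw [show ω ^ 4 = (ω ^ 2) ^ 2 by ring, h]; norm_num))
    (t := ξ ^ j) (by rw [hω, pow_mul]) rfl he2
  rw [Cgam_eq hadd hinv hω4 rfl he2 hω0, Set.ncard_insert_of_notMem,
    Set.ncard_image_of_injective _ (affinePoint_injective _), Set.ncard_coe_finset,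
    Finset.card_product,
    Finset.card_univ, hF, hcard]
  · ring
  · simp only [Set.mem_image, not_exists, not_and]
    exact fun z _ => pointAtInfinity_ne_affinePoint _ z
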